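/- Let x₁, x₂ ∈ ℂ, set x₃ = 1 − x₁ − x₂, and let λ ∈ ℂ with Re(λ) > 0. For each integer k ≥ 0 choose d_k ∈ ℂ with d_k² = (1+k)²/4 − λ(x₃+k) − x₁x₂. Assume x₁, x₂, x₃ and λ are not nonpositive integers and, for every integer k ≥ 0, the numbers λ − (λ−x₁)(λ−x₂)/(λ+k), (1−k)/2 + d_k and (1−k)/2 − d_k are not nonpositive integers. Then both series below converge and Γ(x₁)Γ(x₂)Γ(x₃) / ( Γ(1−x₁)Γ(1−x₂)Γ(1−x₃) ) = ∑_{k=0}^{∞} [ ( 1 − λ + (λ−x₁)(λ−x₂)/(λ+k) )_k² / (k!)² ] · ( 1/(x₁+k) + 1/(x₂+k) − 1/(λ+k) ) + ∑_{k=0}^{∞} [ ( (1−k)/2 + d_k )_k² / (k!)² ] · 1/(x₃+k). -/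

import Mathlib

open Finset Filter Topology Complex

/-- The Pochhammer symbol `(z)_k = z(z+1)⋯(z+k-1)`, with `(z)_0 = 1`. -/
noncomputable def poch (z : ℂ) (k : ℕ) : ℂ := ∏ j ∈ Finset.range k, (z + j)

lemma pf_general {ι : Type*} [DecidableEq ι] (s : Finset ι) (r α β : ι → ℂ)
    (hr : Set.InjOn r s) (x : ℂ) (hx : ∀ i ∈ s, x - r i ≠ 0) :
    ∏ i ∈ s, (α i * x + β i) / (x - r i) = ∏ i ∈ s, α i +
      ∑ i ∈ s, (x - r i)⁻¹ * ((α i * r i + β i) *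
        ∏ j ∈ s.erase i, (α j * r i + β j) / (r i - r j)) := by
  classical
  induction s using Finset.induction_on generalizing x with
  | empty => simp
  | insert a s ha ih =>
    have hr' : Set.InjOn r s := hr.mono (by simp)
    have hne : ∀ i ∈ s, r a - r i ≠ 0 := by
      intro i hi h
      have := hr (by simp) (by simp [hi]) (sub_eq_zero.mp h)
      exact ha (this ▸ hi)
    have h1 := ih hr' x (fun i hi => hx i (by simp [hi]))
    have h2 := ih hr' (r a) hne
    have hxa := hx a (by simp)
    rw [Finset.prod_insert ha, Finset.prod_insert ha, Finset.sum_insert ha,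
      Finset.erase_insert ha, h1, h2]
    have h3 : ∀ i ∈ s, (x - r i)⁻¹ * ((α i * r i + β i) *
        ∏ j ∈ (insert a s).erase i, (α j * r i + β j) / (r i - r j))
        = (x - r i)⁻¹ * ((α a * r i + β a) / (r i - r a)) * ((α i * r i + β i) *
        ∏ j ∈ s.erase i, (α j * r i + β j) / (r i - r j)) := by
      intro i hi
      have : i ≠ a := fun h => ha (h ▸ hi)
      rw [Finset.erase_insert_of_ne this.symm, Finset.prod_insert (by simp [ha])]
      ring
    rw [Finset.sum_congr rfl h3]
    generalize hc : (fun i => ((α i * r i + β i) *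
        ∏ j ∈ s.erase i, (α j * r i + β j) / (r i - r j))) = c
    have hc' : ∀ i, ((α i * r i + β i) *
        ∏ j ∈ s.erase i, (α j * r i + β j) / (r i - r j)) = c i := fun i => congrFun hc i
    simp only [hc']
    have e1 : (α a * x + β a) / (x - r a) = α a + (x - r a)⁻¹ * (α a * r a + β a) := by
      field_simp; ring
    rw [mul_add, mul_add, mul_add, Finset.mul_sum, Finset.mul_sum, Finset.mul_sum, e1, add_mul,
      add_assoc, add_assoc, ← Finset.sum_add_distrib]
    congr 1
    rw [mul_assoc]
    congr 1
    refine Finset.sum_congr rfl fun i hi => ?_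
    have ha1 := hne i hi
    have ha2 : r i - r a ≠ 0 := by rw [← neg_sub]; exact neg_ne_zero.mpr ha1
    have ha3 := hx i (by simp [hi])
    have : (α a * r i + β a) / (r i - r a) = -((α a * r i + β a) / (r a - r i)) := by
      rw [← neg_sub (r a), div_neg]
    rw [this]
    field_simp
    ring

/-- truncated residue -/
noncomputable def Tn (N k : ℕ) (y : ℂ) : ℂ :=
  ((N : ℂ) + 1)⁻¹ * ((∏ n ∈ range (N + 1), ((n : ℂ) + 1 + k)) *
    (∏ n ∈ range (N + 1), ((n : ℂ) + 1 - y)) * (∏ n ∈ range (N + 1), ((n : ℂ) + y - k))) /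
    ((∏ n ∈ (range (N + 1)).erase k, ((n : ℂ) - k)) * (∏ n ∈ range (N + 1), ((n : ℂ) + y)) *
      (∏ n ∈ range (N + 1), ((n : ℂ) + 1 + k - y)))

lemma tele (g : ℕ → ℂ) (M k : ℕ) :
    (∏ n ∈ range M, g (n + k)) * ∏ i ∈ range k, g i
      = (∏ n ∈ range M, g n) * ∏ i ∈ range k, g (M + i) := by
  rw [← Finset.prod_range_add, mul_comm, add_comm M k, Finset.prod_range_add]
  simp [add_comm]

lemma erase_prod (k m : ℕ) :
    ∏ n ∈ (range (k + m + 1)).erase k, ((n : ℂ) - k) = (-1) ^ k * k.factorial * m.factorial := by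
  induction m with
  | zero =>
    have : (range (k + 0 + 1)).erase k = range k := by ext; simp; omega
    rw [this, ← Finset.prod_range_reflect]
    have : ∀ j ∈ range k, (((k - 1 - j : ℕ) : ℂ) - k) = (-1) * ((j : ℂ) + 1) := by
      intro j hj
      have hj := Finset.mem_range.mp hj
      rw [show k - 1 - j = k - (j + 1) by omega, Nat.cast_sub (by omega)]
      push_cast; ring
    rw [Finset.prod_congr rfl this, Finset.prod_mul_distrib, Finset.prod_const,
      ← Finset.prod_range_add_one_eq_factorial]
    push_cast
    simp
  | succ m ih =>
    have : (range (k + (m + 1) + 1)).erase k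
        = insert (k + m + 1) ((range (k + m + 1)).erase k) := by ext; simp; omega
    rw [this, Finset.prod_insert (by simp), ih, Nat.factorial_succ]
    push_cast; ring

noncomputable def rho1 (N k : ℕ) (y : ℂ) : ℂ := ∏ i ∈ range k, (((N : ℂ) - i) / ((N : ℂ) - i + y))
noncomputable def rho2 (N k : ℕ) (y : ℂ) : ℂ :=
  ∏ i ∈ range k, (((N : ℂ) + 2 + i) / ((N : ℂ) + 2 + i - y))

lemma Tn_eq (N k : ℕ) (hk : k ≤ N) (y : ℂ) (h1 : ∀ n : ℕ, (n : ℂ) + y ≠ 0)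
    (h2 : ∀ n : ℕ, (n : ℂ) + 1 + k - y ≠ 0) :
    Tn N k y = (poch (1 - y) k ^ 2 / (k.factorial : ℂ) ^ 2) * (rho1 N k y * rho2 N k y) := by
  obtain ⟨m, rfl⟩ := Nat.exists_eq_add_of_le hk
  set N := k + m with hN
  have ea := tele (fun n => (n : ℂ) + 1) (N + 1) k
  have eb := tele (fun n => (n : ℂ) + 1 - y) (N + 1) k
  have ec := tele (fun n => (n : ℂ) + y - k) (N + 1) k
  have ed := erase_prod k m
  have ef := tele (fun n => (n : ℂ) + 1) m k
  have fac : ∀ M : ℕ, ∏ i ∈ range M, ((i : ℂ) + 1) = M.factorial := by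
    intro M; rw [← Finset.prod_range_add_one_eq_factorial]; push_cast; rfl
  have r1 : ∏ i ∈ range k, ((i : ℂ) + y - k) = (-1) ^ k * poch (1 - y) k := by
    rw [← Finset.prod_range_reflect, poch]
    have : ∀ j ∈ range k, (((k - 1 - j : ℕ) : ℂ) + y - k) = (-1) * (1 - y + j) := by
      intro j hj
      have hj := Finset.mem_range.mp hj
      rw [show k - 1 - j = k - (j + 1) by omega, Nat.cast_sub (by omega)]
      push_cast; ring
    rw [Finset.prod_congr rfl this, Finset.prod_mul_distrib, Finset.prod_const]; simp
  have r2 : ∏ i ∈ range k, (((N + 1 + i : ℕ) : ℂ) + y - k) = ∏ i ∈ range k, ((N : ℂ) - i + y) := by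
    rw [← Finset.prod_range_reflect]
    refine Finset.prod_congr rfl fun j hj => ?_
    have hj := Finset.mem_range.mp hj
    rw [show k - 1 - j = k - (j + 1) by omega]
    push_cast [Nat.cast_sub (show j + 1 ≤ k by omega)]; ring
  have r3 : ∏ i ∈ range k, (((m + i : ℕ) : ℂ) + 1) = ∏ i ∈ range k, ((N : ℂ) - i) := by
    rw [← Finset.prod_range_reflect]
    refine Finset.prod_congr rfl fun j hj => ?_
    have hj := Finset.mem_range.mp hj
    rw [show k - 1 - j = k - (j + 1) by omega, hN]
    push_cast [Nat.cast_sub (show j + 1 ≤ k by omega)]; ring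
  have r4 : ∏ i ∈ range k, (((N + 1 + i : ℕ) : ℂ) + 1) = ∏ i ∈ range k, ((N : ℂ) + 2 + i) :=
    Finset.prod_congr rfl fun j hj => by push_cast; ring
  have r5 : ∏ i ∈ range k, (((N + 1 + i : ℕ) : ℂ) + 1 - y) = ∏ i ∈ range k, ((N : ℂ) + 2 + i - y) :=
    Finset.prod_congr rfl fun j hj => by push_cast; ring
  have r6 : ∏ i ∈ range k, ((i : ℂ) + 1 - y) = poch (1 - y) k :=
    Finset.prod_congr rfl fun j hj => by ring
  have r7 : (∏ n ∈ range m, (((n + k : ℕ) : ℂ) + 1)) * k.factorial = N.factorial := by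
    rw [← fac, ← fac, hN, Finset.prod_range_add, mul_comm]
    refine congrArg _ ?_
    exact Finset.prod_congr rfl fun j hj => by push_cast; ring
  have r8 : ∏ n ∈ range (N + 1), (((n + k : ℕ) : ℂ) + 1) = ∏ n ∈ range (N + 1), ((n : ℂ) + 1 + k) :=
    Finset.prod_congr rfl fun j hj => by push_cast; ring
  have r9 : ∏ n ∈ range (N + 1), (((n + k : ℕ) : ℂ) + 1 - y)
      = ∏ n ∈ range (N + 1), ((n : ℂ) + 1 + k - y) :=
    Finset.prod_congr rfl fun j hj => by push_cast; ring
  have r10 : ∏ n ∈ range (N + 1), (((n + k : ℕ) : ℂ) + y - k)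
      = ∏ n ∈ range (N + 1), ((n : ℂ) + y) :=
    Finset.prod_congr rfl fun j hj => by push_cast; ring
  have n1 : ∏ n ∈ range (N + 1), ((n : ℂ) + y) ≠ 0 := Finset.prod_ne_zero_iff.mpr fun n _ => h1 n
  have n2 : ∏ n ∈ range (N + 1), ((n : ℂ) + 1 + k - y) ≠ 0 :=
    Finset.prod_ne_zero_iff.mpr fun n _ => h2 n
  have n3 : ∏ i ∈ range k, ((N : ℂ) - i + y) ≠ 0 := by
    refine Finset.prod_ne_zero_iff.mpr fun n hn => ?_
    have hn := Finset.mem_range.mp hn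
    have := h1 (N - n)
    rwa [Nat.cast_sub (by omega)] at this
  have n4 : ∏ i ∈ range k, ((N : ℂ) + 2 + i - y) ≠ 0 := by
    refine Finset.prod_ne_zero_iff.mpr fun n hn => ?_
    have := h2 (m + 1 + n)
    rw [hN]; push_cast at this ⊢
    convert this using 1; ring
  have n5 : (k.factorial : ℂ) ≠ 0 := by exact_mod_cast k.factorial_ne_zero
  have n6 : (m.factorial : ℂ) ≠ 0 := by exact_mod_cast m.factorial_ne_zero
  have n7 : (N.factorial : ℂ) ≠ 0 := by exact_mod_cast N.factorial_ne_zero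
  have n8 : (N : ℂ) + 1 ≠ 0 := by exact_mod_cast N.succ_ne_zero
  have n9 : ((-1 : ℂ)) ^ k ≠ 0 := pow_ne_zero _ (by norm_num)
  simp only [r1, r2, r3, r4, r5, r6, r8, r9, r10, fac] at ea eb ec ef
  rw [r7] at ef
  rw [Nat.factorial_succ] at ea
  push_cast at ea
  rw [Tn, ed, rho1, rho2, Finset.prod_div_distrib, Finset.prod_div_distrib]
  generalize ∏ n ∈ range (N + 1), ((n : ℂ) + y) = Pe at *
  generalize ∏ n ∈ range (N + 1), ((n : ℂ) + 1 + k - y) = Pf at *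
  generalize ∏ n ∈ range (N + 1), ((n : ℂ) + 1 + k) = Pa at *
  generalize ∏ n ∈ range (N + 1), ((n : ℂ) + 1 - y) = Pb at *
  generalize ∏ n ∈ range (N + 1), ((n : ℂ) + y - k) = Pc at *
  generalize ∏ i ∈ range k, ((N : ℂ) - i + y) = Q3 at *
  generalize ∏ i ∈ range k, ((N : ℂ) + 2 + i - y) = Q2 at *
  generalize ∏ i ∈ range k, ((N : ℂ) + 2 + i) = Q1 at *
  generalize ∏ i ∈ range k, ((N : ℂ) - i) = Q4 at *
  generalize poch (1 - y) k = p at *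
  have u1 : Pa = (N + 1) * N.factorial * Q1 / k.factorial := by field_simp; exact ea
  have u2 : Pb = Pf * p / Q2 := by field_simp; exact eb.symm
  have u3 : Pc = Pe * ((-1) ^ k * p) / Q3 := by field_simp; rw [← ec]; ring
  have u4 : Q4 = N.factorial / m.factorial := by field_simp; rw [ef]; ring
  rw [u1, u2, u3, u4]
  field_simp

lemma finite_id (x₁ x₂ x₃ lam : ℂ) (hx3 : x₃ = 1 - x₁ - x₂)
    (hx₁ : ∀ m : ℕ, (m : ℂ) + x₁ ≠ 0) (hx₂ : ∀ m : ℕ, (m : ℂ) + x₂ ≠ 0)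
    (hx₃ : ∀ m : ℕ, (m : ℂ) + x₃ ≠ 0) (hlam : ∀ m : ℕ, (m : ℂ) + lam ≠ 0)
    (y z : ℕ → ℂ)
    (hy : ∀ k : ℕ, y k * (lam + k) = lam * (lam + k) - (lam - x₁) * (lam - x₂))
    (hz : ∀ k : ℕ, z k * (1 + k - z k) = x₁ * x₂ + lam * (x₃ + k))
    (hy1 : ∀ k n : ℕ, (n : ℂ) + y k ≠ 0) (hy2 : ∀ k n : ℕ, (n : ℂ) + 1 + k - y k ≠ 0)
    (N : ℕ) :
    ((N : ℂ) + 1)⁻¹ * ∏ n ∈ range (N + 1),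
        (((n : ℂ) + 1 - x₁) * (n + 1 - x₂) * (n + 1 - x₃) / ((n + x₁) * (n + x₂) * (n + x₃)))
      = ((N : ℂ) + 1)⁻¹ * ∏ n ∈ range (N + 1), (((n : ℂ) + 1 - lam) / (n + lam))
        + ∑ k ∈ range (N + 1), Tn N k (y k) * (1 / (x₁ + k) + 1 / (x₂ + k) - 1 / (lam + k))
        + ∑ k ∈ range (N + 1), Tn N k (z k) * (1 / (x₃ + k)) := by
  subst hx3
  set s := x₁ + x₂ with hs
  have hlam' : ∀ m : ℕ, lam + (m : ℂ) ≠ 0 := fun m => by rw [add_comm]; exact hlam m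
  have hyy : ∀ k, y k = lam - (lam - x₁) * (lam - x₂) / (lam + k) := by
    intro k
    have := hy k
    have h := hlam' k
    field_simp
    exact this
  -- quadratics at the two families of nodes
  have q1 : ∀ k n : ℕ, (n + lam) * ((y k - k) - (y n - n)) = ((n : ℂ) - k) * (n + y k) := by
    intro k n
    linear_combination (hy k) - (hy n)
  have q2 : ∀ k n : ℕ, (lam - n - 1) * (y k - k) + ((n + 1) ^ 2 + x₁ * x₂ - lam * s)
      = ((n : ℂ) + 1 + k) * (n + 1 - y k) := by
    intro k n
    rw [hs]; linear_combination (hy k)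
  have q3 : ∀ k n : ℕ, (n + lam) * ((1 + k) - (y n - n)) = ((n : ℂ) + z k) * (n + 1 + k - z k) := by
    intro k n
    linear_combination -(hy n) - (hz k)
  have q4 : ∀ k n : ℕ, (lam - n - 1) * (1 + k) + ((n + 1) ^ 2 + x₁ * x₂ - lam * s)
      = ((n : ℂ) + 1 - z k) * (n + z k - k) := by
    intro k n
    rw [hs]; linear_combination -(hz k)
  have q5 : ∀ n : ℕ, (n + lam) * (s - (y n - n)) = ((n : ℂ) + x₁) * (n + x₂) := by
    intro n
    rw [hs]; linear_combination -(hy n)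
  have q6 : ∀ n : ℕ, (lam - n - 1) * s + ((n + 1) ^ 2 + x₁ * x₂ - lam * s)
      = ((n : ℂ) + 1 - x₁) * (n + 1 - x₂) := by
    intro n
    rw [hs]; ring
  let r : ℕ ⊕ ℕ → ℂ := Sum.elim (fun n => y n - n) (fun n => 1 + n)
  let α : ℕ ⊕ ℕ → ℂ := Sum.elim (fun n => (lam - n - 1) / (n + lam)) (fun n => -1)
  let β : ℕ ⊕ ℕ → ℂ := Sum.elim (fun n => ((n + 1) ^ 2 + x₁ * x₂ - lam * s) / (n + lam))
    (fun n => -n)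
  have hr : Set.InjOn r ((range (N + 1)).disjSum (range (N + 1))) := by
    rintro (k | k) - (n | n) - h
    · by_contra hkn
      have hkn' : (n : ℂ) - k ≠ 0 := by
        intro h'
        apply hkn
        have : (n : ℂ) = k := sub_eq_zero.mp h'
        rw [Nat.cast_inj.mp this]
      have h1 := q1 k n
      have h2 : y k - k = y n - n := h
      rw [h2, sub_self, mul_zero] at h1
      exact mul_ne_zero hkn' (hy1 k n) h1.symm
    · exfalso
      have h2 : y k - k = 1 + n := h
      exact hy2 k n (by linear_combination -h2)
    · exfalso
      have h2 : 1 + (k : ℂ) = y n - n := h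
      exact hy2 n k (by linear_combination h2)
    · have h2 : 1 + (k : ℂ) = 1 + n := h
      have h3 : (k : ℂ) = n := by linear_combination h2
      rw [Nat.cast_inj.mp h3]
  have hx : ∀ i ∈ (range (N + 1)).disjSum (range (N + 1)), s - r i ≠ 0 := by
    rintro (n | n) - h
    · have h : s - (y n - n) = 0 := h
      have := q5 n
      rw [h, mul_zero] at this
      exact mul_ne_zero (hx₁ n) (hx₂ n) this.symm
    · have h : s - (1 + n) = 0 := h
      exact hx₃ n (by rw [hs] at h; linear_combination -h)
  have key := pf_general ((range (N + 1)).disjSum (range (N + 1))) r α β hr s hx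
  rw [Finset.prod_disjSum, Finset.prod_disjSum, Finset.sum_disjSum] at key
  have n8 : (N : ℂ) + 1 ≠ 0 := by exact_mod_cast N.succ_ne_zero
  have L : ∏ n ∈ range (N + 1),
        (((n : ℂ) + 1 - x₁) * (n + 1 - x₂) * (n + 1 - (1 - x₁ - x₂)) /
          ((n + x₁) * (n + x₂) * (n + (1 - x₁ - x₂))))
      = (∏ n ∈ range (N + 1), (α (Sum.inl n) * s + β (Sum.inl n)) / (s - r (Sum.inl n))) *
        ∏ n ∈ range (N + 1), (α (Sum.inr n) * s + β (Sum.inr n)) / (s - r (Sum.inr n)) := by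
    rw [← Finset.prod_mul_distrib]
    refine Finset.prod_congr rfl fun n hn => ?_
    have a1 : s - (y n - n) ≠ 0 := hx (Sum.inl n) (by simpa using hn)
    have a2 : s - (1 + n) ≠ 0 := hx (Sum.inr n) (by simpa using hn)
    have b1 : (α (Sum.inl n) * s + β (Sum.inl n)) / (s - r (Sum.inl n))
        = (((n : ℂ) + 1 - x₁) * (n + 1 - x₂)) / ((n + x₁) * (n + x₂)) := by
      rw [← q5, ← q6]
      show ((lam - n - 1) / (n + lam) * s + ((n + 1) ^ 2 + x₁ * x₂ - lam * s) / (n + lam)) /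
        (s - (y n - n)) = _
      have := hlam n
      field_simp
    have b2 : (α (Sum.inr n) * s + β (Sum.inr n)) / (s - r (Sum.inr n))
        = ((n : ℂ) + 1 - (1 - x₁ - x₂)) / (n + (1 - x₁ - x₂)) := by
      show (-1 * s + - (n : ℂ)) / (s - (1 + n)) = _
      rw [← neg_div_neg_eq, hs]
      congr 1 <;> ring
    rw [b1, b2, div_mul_div_comm]
  have A : ∏ n ∈ range (N + 1), (((n : ℂ) + 1 - lam) / (n + lam))
      = (∏ n ∈ range (N + 1), α (Sum.inl n)) * ∏ n ∈ range (N + 1), α (Sum.inr n) := by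
    rw [← Finset.prod_mul_distrib]
    refine Finset.prod_congr rfl fun n hn => ?_
    show _ = (lam - n - 1) / (n + lam) * (-1)
    ring
  rw [L, key, A, mul_add, mul_add, add_assoc]
  congr 1
  rw [Finset.mul_sum, Finset.mul_sum]
  have eraseL : ∀ k, ((range (N + 1)).disjSum (range (N + 1))).erase (Sum.inl k)
      = ((range (N + 1)).erase k).disjSum (range (N + 1)) := by
    intro k; ext (i | i) <;> simp
  have eraseR : ∀ k, ((range (N + 1)).disjSum (range (N + 1))).erase (Sum.inr k)
      = (range (N + 1)).disjSum ((range (N + 1)).erase k) := by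
    intro k; ext (i | i) <;> simp
  congr 1
  · refine Finset.sum_congr rfl fun k hk => ?_
    rw [eraseL, Finset.prod_disjSum]
    have a1 : s - (y k - k) ≠ 0 := hx (Sum.inl k) (by simpa using hk)
    have c1 : ∏ n ∈ (range (N + 1)).erase k,
        (α (Sum.inl n) * r (Sum.inl k) + β (Sum.inl n)) / (r (Sum.inl k) - r (Sum.inl n))
        = (∏ n ∈ (range (N + 1)).erase k, ((n : ℂ) + 1 + k)) *
          (∏ n ∈ (range (N + 1)).erase k, ((n : ℂ) + 1 - y k)) /
          ((∏ n ∈ (range (N + 1)).erase k, ((n : ℂ) - k)) *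
          (∏ n ∈ (range (N + 1)).erase k, ((n : ℂ) + y k))) := by
      rw [← Finset.prod_mul_distrib, ← Finset.prod_mul_distrib, ← Finset.prod_div_distrib]
      refine Finset.prod_congr rfl fun n hn => ?_
      rw [← q1, ← q2]
      show ((lam - n - 1) / (n + lam) * (y k - k) + ((n + 1) ^ 2 + x₁ * x₂ - lam * s) / (n + lam)) /
        ((y k - k) - (y n - n)) = _
      have := hlam n
      rw [← div_div, div_mul_eq_mul_div, ← add_div]
    have c2 : ∏ n ∈ range (N + 1),
        (α (Sum.inr n) * r (Sum.inl k) + β (Sum.inr n)) / (r (Sum.inl k) - r (Sum.inr n))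
        = (∏ n ∈ range (N + 1), ((n : ℂ) + y k - k)) /
          (∏ n ∈ range (N + 1), ((n : ℂ) + 1 + k - y k)) := by
      rw [← Finset.prod_div_distrib]
      refine Finset.prod_congr rfl fun n hn => ?_
      show (-1 * (y k - k) + - (n : ℂ)) / ((y k - k) - (1 + n)) = _
      rw [← neg_div_neg_eq]
      congr 1 <;> ring
    have c3 : α (Sum.inl k) * r (Sum.inl k) + β (Sum.inl k)
        = ((k : ℂ) + 1 + k) * (k + 1 - y k) / (k + lam) := by
      rw [← q2]
      show (lam - k - 1) / (k + lam) * (y k - k) + ((k + 1) ^ 2 + x₁ * x₂ - lam * s) / (k + lam) = _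
      ring
    have w : 1 / (x₁ + k) + 1 / (x₂ + k) - 1 / (lam + k)
        = (k + y k) / ((k + lam) * (s - (y k - k))) := by
      rw [q5]
      have e1 := hx₁ k
      have e2 := hx₂ k
      have e3 := hlam k
      rw [add_comm x₁, add_comm x₂, add_comm lam, hyy, add_comm lam]
      field_simp
      ring
    rw [c1, c2, c3, w, Tn, ← Finset.mul_prod_erase (range (N + 1)) (fun n => (n : ℂ) + 1 + k) hk,
      ← Finset.mul_prod_erase (range (N + 1)) (fun n => (n : ℂ) + 1 - y k) hk,
      ← Finset.mul_prod_erase (range (N + 1)) (fun n => (n : ℂ) + y k) hk]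
    show _ * ((s - (y k - k))⁻¹ * _) = _
    have e3 := hlam k
    have e4 := hy1 k k
    field_simp
  · refine Finset.sum_congr rfl fun k hk => ?_
    rw [eraseR, Finset.prod_disjSum]
    have c1 : ∏ n ∈ range (N + 1),
        (α (Sum.inl n) * r (Sum.inr k) + β (Sum.inl n)) / (r (Sum.inr k) - r (Sum.inl n))
        = (∏ n ∈ range (N + 1), ((n : ℂ) + 1 - z k)) *
          (∏ n ∈ range (N + 1), ((n : ℂ) + z k - k)) /
          ((∏ n ∈ range (N + 1), ((n : ℂ) + z k)) *
          (∏ n ∈ range (N + 1), ((n : ℂ) + 1 + k - z k))) := by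
      rw [← Finset.prod_mul_distrib, ← Finset.prod_mul_distrib, ← Finset.prod_div_distrib]
      refine Finset.prod_congr rfl fun n hn => ?_
      rw [← q3, ← q4]
      show ((lam - n - 1) / (n + lam) * (1 + k) + ((n + 1) ^ 2 + x₁ * x₂ - lam * s) / (n + lam)) /
        ((1 + k) - (y n - n)) = _
      rw [← div_div, div_mul_eq_mul_div, ← add_div]
    have c2 : ∏ n ∈ (range (N + 1)).erase k,
        (α (Sum.inr n) * r (Sum.inr k) + β (Sum.inr n)) / (r (Sum.inr k) - r (Sum.inr n))
        = (∏ n ∈ (range (N + 1)).erase k, ((n : ℂ) + 1 + k)) /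
          (∏ n ∈ (range (N + 1)).erase k, ((n : ℂ) - k)) := by
      rw [← Finset.prod_div_distrib]
      refine Finset.prod_congr rfl fun n hn => ?_
      show (-1 * (1 + (k : ℂ)) + - (n : ℂ)) / ((1 + k) - (1 + n)) = _
      rw [← neg_div_neg_eq]
      congr 1 <;> ring
    have c3 : α (Sum.inr k) * r (Sum.inr k) + β (Sum.inr k) = -((k : ℂ) + 1 + k) := by
      show -1 * (1 + (k : ℂ)) + -(k : ℂ) = _
      ring
    have c4 : (s - r (Sum.inr k))⁻¹ = -(1 / (1 - x₁ - x₂ + k)) := by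
      show (s - (1 + (k : ℂ)))⁻¹ = _
      rw [one_div, ← inv_neg, hs]
      congr 1; ring
    rw [c1, c2, c3, c4, Tn, ← Finset.mul_prod_erase (range (N + 1)) (fun n => (n : ℂ) + 1 + k) hk]
    simp only [div_eq_mul_inv, mul_inv]
    ring

lemma gammaSeq_inv (z : ℂ) :
    Tendsto (fun n => (Complex.GammaSeq z n)⁻¹) atTop (𝓝 (Complex.Gamma z)⁻¹) := by
  by_cases h : ∃ m : ℕ, z = -(m : ℂ)
  · obtain ⟨m, rfl⟩ := h
    rw [Complex.Gamma_neg_nat_eq_zero, inv_zero]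
    refine tendsto_const_nhds.congr' ?_
    filter_upwards [eventually_ge_atTop m] with n hn
    have : ∏ j ∈ range (n + 1), (-(m : ℂ) + j) = 0 :=
      Finset.prod_eq_zero (i := m) (by simp; omega) (by simp)
    rw [Complex.GammaSeq, this]; simp
  · push Not at h
    exact (Complex.GammaSeq_tendsto_Gamma z).inv₀ (Complex.Gamma_ne_zero h)

lemma gamma_limit (x₁ x₂ x₃ : ℂ) (hx3 : x₃ = 1 - x₁ - x₂) :
    Tendsto (fun N : ℕ => ((N : ℂ) + 1)⁻¹ * ∏ n ∈ range (N + 1),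
        (((n : ℂ) + 1 - x₁) * (n + 1 - x₂) * (n + 1 - x₃) / ((n + x₁) * (n + x₂) * (n + x₃))))
      atTop (𝓝 (Complex.Gamma x₁ * Complex.Gamma x₂ * Complex.Gamma x₃
          / (Complex.Gamma (1 - x₁) * Complex.Gamma (1 - x₂)
            * Complex.Gamma (1 - x₃)))) := by
  have h1 : Tendsto (fun N : ℕ => (N : ℂ) / ((N : ℂ) + 1)) atTop (𝓝 1) :=
    tendsto_natCast_div_add_atTop 1
  have h := h1.mul ((((Complex.GammaSeq_tendsto_Gamma x₁).mul
    (Complex.GammaSeq_tendsto_Gamma x₂)).mul (Complex.GammaSeq_tendsto_Gamma x₃)).mul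
    (((gammaSeq_inv (1 - x₁)).mul (gammaSeq_inv (1 - x₂))).mul (gammaSeq_inv (1 - x₃))))
  rw [one_mul, ← mul_inv, ← mul_inv, ← div_eq_mul_inv] at h
  refine h.congr' ?_
  filter_upwards [eventually_ge_atTop 1] with N hN
  have hN0 : (N : ℂ) ≠ 0 := by exact_mod_cast (by omega : N ≠ 0)
  have e1 : (N : ℂ) ^ x₁ * (N : ℂ) ^ x₂ * (N : ℂ) ^ x₃ = N := by
    rw [← Complex.cpow_add _ _ hN0, ← Complex.cpow_add _ _ hN0, hx3,
      show x₁ + x₂ + (1 - x₁ - x₂) = 1 by ring, Complex.cpow_one]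
  have e2 : (N : ℂ) ^ (1 - x₁) * (N : ℂ) ^ (1 - x₂) * (N : ℂ) ^ (1 - x₃) = N ^ 2 := by
    rw [← Complex.cpow_add _ _ hN0, ← Complex.cpow_add _ _ hN0, hx3,
      show 1 - x₁ + (1 - x₂) + (1 - (1 - x₁ - x₂)) = 2 by ring]
    exact_mod_cast Complex.cpow_natCast (N : ℂ) 2
  have n5 : (N.factorial : ℂ) ≠ 0 := by exact_mod_cast N.factorial_ne_zero
  have p1 : ∀ x : ℂ, ∏ n ∈ range (N + 1), ((n : ℂ) + 1 - x) = ∏ n ∈ range (N + 1), (1 - x + n) :=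
    fun x => Finset.prod_congr rfl fun n _ => by ring
  have p2 : ∀ x : ℂ, ∏ n ∈ range (N + 1), ((n : ℂ) + x) = ∏ n ∈ range (N + 1), (x + n) :=
    fun x => Finset.prod_congr rfl fun n _ => by ring
  simp only [Finset.prod_div_distrib, Finset.prod_mul_distrib, p1, p2, Complex.GammaSeq]
  generalize ∏ n ∈ range (N + 1), (x₁ + (n : ℂ)) = a1
  generalize ∏ n ∈ range (N + 1), (x₂ + (n : ℂ)) = a2
  generalize ∏ n ∈ range (N + 1), (x₃ + (n : ℂ)) = a3
  generalize ∏ n ∈ range (N + 1), (1 - x₁ + (n : ℂ)) = b1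
  generalize ∏ n ∈ range (N + 1), (1 - x₂ + (n : ℂ)) = b2
  generalize ∏ n ∈ range (N + 1), (1 - x₃ + (n : ℂ)) = b3
  have : ∀ u1 u2 u3 v1 v2 v3 f : ℂ, (u1 * f / a1) * (u2 * f / a2) * (u3 * f / a3) *
      ((v1 * f / b1)⁻¹ * (v2 * f / b2)⁻¹ * (v3 * f / b3)⁻¹)
      = (u1 * u2 * u3) * (v1 * v2 * v3)⁻¹ * (f * f⁻¹) ^ 3 * (b1 * b2 * b3 / (a1 * a2 * a3)) := by
    intro u1 u2 u3 v1 v2 v3 f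
    simp only [div_eq_mul_inv, mul_inv, inv_inv]; ring
  rw [this, e1, e2, mul_inv_cancel₀ n5]
  have n8 : (N : ℂ) + 1 ≠ 0 := by exact_mod_cast N.succ_ne_zero
  generalize (b1 * b2 * b3 / (a1 * a2 * a3)) = q
  field_simp

lemma poch_bound (y : ℂ) (δ B : ℝ) (hδ : 0 ≤ δ) (h1 : δ ≤ y.re) (h2 : ‖y‖ ≤ B) (k : ℕ) :
    ‖poch (1 - y) k‖ ≤ k.factorial *
      Real.exp (-δ * Real.log (k + 1) + B ^ 2 * (1 - 1 / ((k : ℝ) + 1))) := by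
  induction k with
  | zero => simp [poch]
  | succ k ih =>
    have hs : poch (1 - y) (k + 1) = poch (1 - y) k * (1 - y + k) := by
      simp [poch, Finset.prod_range_succ]
    set m : ℝ := (k : ℝ) + 1 with hm
    have hmp : 0 < m := by positivity
    have f1 : ‖1 - y + k‖ ≤ m * Real.exp (-δ / m + B ^ 2 / (2 * m ^ 2)) := by
      have : ‖1 - y + k‖ ^ 2 ≤ (m * Real.exp (-δ / m + B ^ 2 / (2 * m ^ 2))) ^ 2 := by
        have e : ‖1 - y + k‖ ^ 2 = m ^ 2 - 2 * m * y.re + ‖y‖ ^ 2 := by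
          rw [Complex.sq_norm, Complex.sq_norm, Complex.normSq_apply, Complex.normSq_apply]
          simp [hm]; ring
        have e2 : (m * Real.exp (-δ / m + B ^ 2 / (2 * m ^ 2))) ^ 2
            = m ^ 2 * Real.exp (2 * (-δ / m + B ^ 2 / (2 * m ^ 2))) := by
          rw [mul_pow, ← Real.exp_nat_mul]; norm_num
        rw [e, e2]
        have h3 := Real.add_one_le_exp (2 * (-δ / m + B ^ 2 / (2 * m ^ 2)))
        have h4 : ‖y‖ ^ 2 ≤ B ^ 2 := pow_le_pow_left₀ (norm_nonneg _) h2 2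
        calc m ^ 2 - 2 * m * y.re + ‖y‖ ^ 2 ≤ m ^ 2 - 2 * m * δ + B ^ 2 := by
              have := mul_le_mul_of_nonneg_left h1 hmp.le
              linarith
          _ = m ^ 2 * (2 * (-δ / m + B ^ 2 / (2 * m ^ 2)) + 1) := by field_simp; ring
          _ ≤ _ := mul_le_mul_of_nonneg_left h3 (by positivity)
      exact le_of_sq_le_sq this (by positivity)
    have hlog : Real.log (m + 1) ≤ Real.log m + 1 / m := by
      have : Real.log ((m + 1) / m) ≤ (m + 1) / m - 1 := Real.log_le_sub_one_of_pos (by positivity)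
      rw [Real.log_div (by positivity) (by positivity)] at this
      have e : (m + 1) / m - 1 = 1 / m := by field_simp; ring
      linarith
    rw [hs, norm_mul, Nat.factorial_succ]
    push_cast
    rw [← hm]
    calc _ ≤ (k.factorial * Real.exp (-δ * Real.log m + B ^ 2 * (1 - 1 / m))) *
          (m * Real.exp (-δ / m + B ^ 2 / (2 * m ^ 2))) :=
          mul_le_mul ih f1 (norm_nonneg _) (by positivity)
      _ = m * k.factorial * Real.exp ((-δ * Real.log m + B ^ 2 * (1 - 1 / m)) +
          (-δ / m + B ^ 2 / (2 * m ^ 2))) := by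
          rw [Real.exp_add (-δ * Real.log m + B ^ 2 * (1 - 1 / m))]; ring
      _ ≤ _ := by
        refine mul_le_mul_of_nonneg_left (Real.exp_le_exp.mpr ?_) (by positivity)
        have a1 : δ * Real.log (m + 1) ≤ δ * (Real.log m + 1 / m) :=
          mul_le_mul_of_nonneg_left hlog hδ
        have a2 : 1 / (2 * m ^ 2) ≤ 1 / m - 1 / (m + 1) := by
          rw [div_sub_div _ _ (by positivity) (by positivity), div_le_div_iff₀ (by positivity)
            (by positivity)]
          have : 1 ≤ m := by rw [hm]; linarith [(Nat.cast_nonneg k : (0 : ℝ) ≤ k)]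
          nlinarith
        have a3 : B ^ 2 * (1 / (2 * m ^ 2)) ≤ B ^ 2 * (1 / m - 1 / (m + 1)) :=
          mul_le_mul_of_nonneg_left a2 (sq_nonneg B)
        have a4 : B ^ 2 / (2 * m ^ 2) = B ^ 2 * (1 / (2 * m ^ 2)) := by ring
        have a5 : -δ / m = - (δ * (1 / m)) := by ring
        rw [a4, a5]
        linarith

lemma poch_bound' (y : ℂ) (δ B : ℝ) (hδ : 0 ≤ δ) (h1 : δ ≤ y.re) (h2 : ‖y‖ ≤ B) (k : ℕ) :
    ‖poch (1 - y) k‖ ≤ k.factorial * (Real.exp (B ^ 2) * ((k : ℝ) + 1) ^ (-δ)) := by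
  refine (poch_bound y δ B hδ h1 h2 k).trans ?_
  refine mul_le_mul_of_nonneg_left ?_ (by positivity)
  rw [Real.rpow_def_of_pos (by positivity), ← Real.exp_add]
  refine Real.exp_le_exp.mpr ?_
  have : B ^ 2 * (1 - 1 / ((k : ℝ) + 1)) ≤ B ^ 2 * 1 := by
    refine mul_le_mul_of_nonneg_left ?_ (sq_nonneg B)
    have : 0 ≤ 1 / ((k : ℝ) + 1) := by positivity
    linarith
  linarith

lemma le_norm_nat_add (m : ℕ) (y : ℂ) (hy : 0 ≤ y.re) : (m : ℝ) ≤ ‖(m : ℂ) + y‖ := by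
  have := Complex.re_le_norm ((m : ℂ) + y)
  simp at this
  linarith

lemma const_limit (lam : ℂ) (hre : 0 < lam.re) :
    Tendsto (fun N : ℕ => ((N : ℂ) + 1)⁻¹ * ∏ n ∈ range (N + 1), (((n : ℂ) + 1 - lam) / (n + lam)))
      atTop (𝓝 0) := by
  have hl0 : lam ≠ 0 := by rintro rfl; simp at hre
  have hl : 0 < ‖lam‖ := norm_pos_iff.mpr hl0
  have lim : Tendsto (fun N : ℕ => (Real.exp (‖lam‖ ^ 2) / ‖lam‖) * (((N + 1 : ℕ) : ℝ) + 1) ^ (-lam.re))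
      atTop (𝓝 0) := by
    rw [← mul_zero (Real.exp (‖lam‖ ^ 2) / ‖lam‖)]
    refine Tendsto.const_mul _ ?_
    refine (tendsto_rpow_neg_atTop hre).comp ?_
    refine tendsto_atTop_add_const_right _ _ ?_
    exact tendsto_natCast_atTop_atTop.comp (tendsto_add_atTop_nat 1)
  refine squeeze_zero_norm (fun N => ?_) lim
  have hb := poch_bound' lam lam.re ‖lam‖ hre.le le_rfl le_rfl (N + 1)
  have e : ∏ n ∈ range (N + 1), ((n : ℂ) + 1 - lam) = poch (1 - lam) (N + 1) :=
    Finset.prod_congr rfl fun n _ => by ring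
  have hd : ‖lam‖ * N.factorial ≤ ‖∏ n ∈ range (N + 1), ((n : ℂ) + lam)‖ := by
    rw [Finset.prod_range_succ', norm_mul, norm_prod, mul_comm, ← Finset.prod_range_add_one_eq_factorial]
    simp only [Nat.cast_zero, zero_add]
    push_cast
    refine mul_le_mul_of_nonneg_right ?_ hl.le
    refine Finset.prod_le_prod (fun i _ => by positivity) fun i _ => ?_
    have := le_norm_nat_add (i + 1) lam hre.le
    push_cast at this
    exact this
  have n1 : ‖(N : ℂ) + 1‖ = (N : ℝ) + 1 := by
    rw [← Nat.cast_add_one, Complex.norm_natCast]; push_cast; rfl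
  rw [Finset.prod_div_distrib, e, norm_mul, norm_div, norm_inv, n1]
  have hf : (0 : ℝ) < N.factorial := by positivity
  calc _ ≤ ((N : ℝ) + 1)⁻¹ * (((N + 1).factorial * (Real.exp (‖lam‖ ^ 2) *
        (((N + 1 : ℕ) : ℝ) + 1) ^ (-lam.re))) / (‖lam‖ * N.factorial)) := by
        gcongr
    _ = _ := by
        rw [Nat.factorial_succ]
        push_cast
        field_simp

lemma rho1_bound (N k : ℕ) (hk : k ≤ N) (y : ℂ) (hy : 0 ≤ y.re) : ‖rho1 N k y‖ ≤ 1 := by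
  rw [rho1, norm_prod]
  refine Finset.prod_le_one (fun i _ => norm_nonneg _) fun i hi => ?_
  have hi := Finset.mem_range.mp hi
  rw [← Nat.cast_sub (by omega : i ≤ N), norm_div, Complex.norm_natCast]
  exact div_le_one_of_le₀ (le_norm_nat_add _ _ hy) (norm_nonneg _)

lemma rho2_bound (N k : ℕ) (hk : k ≤ N) (y : ℂ) (B : ℝ) (hy : ‖y‖ ≤ B) (hN : 2 * B ≤ N) :
    ‖rho2 N k y‖ ≤ Real.exp (2 * B) := by
  have hB : 0 ≤ B := (norm_nonneg _).trans hy
  rw [rho2, norm_prod]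
  have : ∀ i ∈ range k, ‖((N : ℂ) + 2 + i) / ((N : ℂ) + 2 + i - y)‖
      ≤ Real.exp (2 * B / (N + 1)) := by
    intro i _
    have e : (N : ℂ) + 2 + i = ((N + 2 + i : ℕ) : ℂ) := by push_cast; rfl
    set t : ℝ := ((N + 2 + i : ℕ) : ℝ) with ht
    have ht2 : (N : ℝ) + 2 ≤ t := by
      rw [ht]; push_cast; linarith [(Nat.cast_nonneg i : (0 : ℝ) ≤ i)]
    rw [e, norm_div, Complex.norm_natCast, ← ht]
    have h1 : t - B ≤ ‖((N + 2 + i : ℕ) : ℂ) - y‖ := by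
      have := norm_sub_norm_le ((N + 2 + i : ℕ) : ℂ) y
      rw [Complex.norm_natCast, ← ht] at this
      linarith
    have hN0 : (0 : ℝ) ≤ N := Nat.cast_nonneg N
    have h2 : 0 < t - B := by linarith
    refine le_trans ?_ (Real.add_one_le_exp _)
    rw [div_le_iff₀ (by linarith)]
    refine le_trans ?_ (mul_le_mul_of_nonneg_left h1 (by positivity))
    have : 0 ≤ B * (2 * (t - B) - (N + 1)) / (N + 1) := by
      apply div_nonneg (mul_nonneg hB (by linarith)) (by positivity)
    have e3 : (2 * B / (N + 1) + 1) * (t - B) = t + B * (2 * (t - B) - (N + 1)) / (N + 1) := by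
      field_simp; ring
    rw [e3]; linarith
  refine (Finset.prod_le_prod (fun i _ => norm_nonneg _) this).trans ?_
  rw [Finset.prod_const, Finset.card_range, ← Real.exp_nat_mul]
  refine Real.exp_le_exp.mpr ?_
  have hk' : (k : ℝ) ≤ N := by exact_mod_cast hk
  have : (k : ℝ) * (2 * B / (N + 1)) = (2 * B) * (k / (N + 1)) := by ring
  rw [this]
  refine mul_le_of_le_one_right (by positivity) ?_
  rw [div_le_one (by positivity)]; linarith

lemma inv_limit (b : ℂ) : Tendsto (fun N : ℕ => ((N : ℂ) + b)⁻¹) atTop (𝓝 0) :=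
  tendsto_inv₀_cobounded.comp
    ((tendsto_add_const_cobounded b).comp tendsto_natCast_atTop_cobounded)

lemma rho_limit (k : ℕ) (y : ℂ) :
    Tendsto (fun N : ℕ => rho1 N k y * rho2 N k y) atTop (𝓝 1) := by
  have key : ∀ a b : ℂ, Tendsto (fun N : ℕ => ((N : ℂ) + a) / ((N : ℂ) + b)) atTop (𝓝 1) := by
    intro a b
    have h1 : Tendsto (fun N : ℕ => (N : ℂ) / ((N : ℂ) + b)) atTop (𝓝 1) :=
      tendsto_natCast_div_add_atTop b
    have h2 := inv_limit b
    have := h1.add (h2.const_mul a)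
    rw [mul_zero, add_zero] at this
    refine this.congr fun N => ?_
    rw [add_div, div_eq_mul_inv a]
  have h1 : Tendsto (fun N : ℕ => rho1 N k y) atTop (𝓝 (∏ i ∈ range k, (1 : ℂ))) := by
    refine tendsto_finsetProd _ fun i _ => ?_
    refine (key (-i) (-i + y)).congr fun N => ?_
    congr 1; ring
  have h2 : Tendsto (fun N : ℕ => rho2 N k y) atTop (𝓝 (∏ i ∈ range k, (1 : ℂ))) := by
    refine tendsto_finsetProd _ fun i _ => ?_
    refine (key (2 + i) (2 + i - y)).congr fun N => ?_
    congr 1 <;> ring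
  simpa using h1.mul h2

lemma tannery (lam : ℂ) (hre : 0 < lam.re) (y w : ℕ → ℂ) (hy : Tendsto y atTop (𝓝 lam))
    (W : ℝ) (hw : ∀ k : ℕ, ‖w k‖ ≤ W / ((k : ℝ) + 1))
    (h1 : ∀ k n : ℕ, (n : ℂ) + y k ≠ 0) (h2 : ∀ k n : ℕ, (n : ℂ) + 1 + k - y k ≠ 0) :
    Summable (fun k : ℕ => (poch (1 - y k) k ^ 2 / (k.factorial : ℂ) ^ 2) * w k) ∧
    Tendsto (fun N : ℕ => ∑ k ∈ range (N + 1), Tn N k (y k) * w k) atTop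
      (𝓝 (∑' k : ℕ, (poch (1 - y k) k ^ 2 / (k.factorial : ℂ) ^ 2) * w k)) := by
  set f : ℕ → ℂ := fun k => (poch (1 - y k) k ^ 2 / (k.factorial : ℂ) ^ 2) * w k with hf
  obtain ⟨B, hB⟩ : ∃ B : ℝ, ∀ k, ‖y k‖ ≤ B := by
    obtain ⟨B, hB⟩ := hy.norm.bddAbove_range
    exact ⟨B, fun k => hB ⟨k, rfl⟩⟩
  have hB0 : 0 ≤ B := (norm_nonneg _).trans (hB 0)
  have hW : 0 ≤ W := by have := (norm_nonneg _).trans (hw 0); simpa using this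
  set δ := lam.re / 2 with hδ
  have hδ0 : 0 < δ := by positivity
  obtain ⟨K, hK⟩ : ∃ K : ℕ, ∀ k ≥ K, δ ≤ (y k).re := by
    have : Tendsto (fun k => (y k).re) atTop (𝓝 lam.re) :=
      (Complex.continuous_re.tendsto _).comp hy
    have := this.eventually (lt_mem_nhds (show δ < lam.re by rw [hδ]; linarith))
    obtain ⟨K, hK⟩ := eventually_atTop.mp this
    exact ⟨K, fun k hk => (hK k hk).le⟩
  set C := Real.exp (B ^ 2) ^ 2 * W with hC
  have hC0 : 0 ≤ C := by positivity
  have fb : ∀ k ≥ K, ‖f k‖ ≤ C * ((k : ℝ) + 1) ^ (-(1 + 2 * δ)) := by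
    intro k hk
    have hb := poch_bound' (y k) δ B hδ0.le (hK k hk) (hB k) k
    have hk0 : (0 : ℝ) < (k : ℝ) + 1 := by positivity
    have hfac : (0 : ℝ) < k.factorial := by positivity
    rw [hf]
    simp only [norm_mul, norm_div, norm_pow, Complex.norm_natCast]
    calc _ ≤ (k.factorial * (Real.exp (B ^ 2) * ((k : ℝ) + 1) ^ (-δ))) ^ 2 / (k.factorial : ℝ) ^ 2 *
          (W / ((k : ℝ) + 1)) := by
          gcongr
          exact hw k
      _ = C * ((((k : ℝ) + 1) ^ (-δ)) ^ 2 * ((k : ℝ) + 1)⁻¹) := by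
          rw [hC]; field_simp
      _ = _ := by
          rw [← Real.rpow_natCast, ← Real.rpow_mul hk0.le, ← Real.rpow_neg_one ((k : ℝ) + 1),
            ← Real.rpow_add hk0]
          congr 2; push_cast; ring
  set g : ℕ → ℝ := fun k => (C * Real.exp (2 * B)) * ((k : ℝ) + 1) ^ (-(1 + 2 * δ)) with hg
  have sg0 : Summable (fun k : ℕ => ((k : ℝ) + 1) ^ (-(1 + 2 * δ))) := by
    have := (Real.summable_nat_rpow (p := -(1 + 2 * δ))).mpr (by linarith)
    have := (summable_nat_add_iff 1).mpr this
    simpa using this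
  have sg : Summable g := sg0.mul_left _
  set b : ℕ → ℝ := fun k => g k + (if k < K then ‖f k‖ + 1 else 0) with hb
  have sb : Summable b := by
    refine sg.add (summable_of_hasFiniteSupport ?_)
    refine (Set.finite_lt_nat K).subset ?_
    intro k hk
    by_contra h
    simp at h
    simp at hk
    omega
  have hgn : ∀ k, 0 ≤ g k := fun k => by rw [hg]; positivity
  have fle : ∀ k, ‖f k‖ ≤ b k := by
    intro k
    rw [hb]
    by_cases hk : k < K
    · simp only [hk, if_true]; linarith [hgn k]
    · simp only [hk, if_false, add_zero]
      refine (fb k (by omega)).trans ?_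
      rw [hg]
      have : 1 ≤ Real.exp (2 * B) := Real.one_le_exp (by positivity)
      have h3 : C ≤ C * Real.exp (2 * B) := le_mul_of_one_le_right hC0 this
      exact mul_le_mul_of_nonneg_right h3 (by positivity)
  refine ⟨Summable.of_norm_bounded sb fle, ?_⟩
  set F : ℕ → ℕ → ℂ := fun N k => if k ∈ range (N + 1) then
    f k * (rho1 N k (y k) * rho2 N k (y k)) else 0 with hF
  have hFs : ∀ N, ∑' k, F N k = ∑ k ∈ range (N + 1), Tn N k (y k) * w k := by
    intro N
    rw [tsum_eq_sum (s := range (N + 1)) (fun k hk => by rw [hF]; simp only [hk, if_false])]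
    refine Finset.sum_congr rfl fun k hk => ?_
    rw [hF]
    simp only [hk, if_true]
    rw [Tn_eq N k (by simp at hk; omega) (y k) (h1 k) (h2 k), hf]
    ring
  have hlim : ∀ k, Tendsto (fun N => F N k) atTop (𝓝 (f k)) := by
    intro k
    have := (rho_limit k (y k)).const_mul (f k)
    rw [mul_one] at this
    refine this.congr' ?_
    filter_upwards [eventually_ge_atTop k] with N hN
    rw [hF]
    simp only [Finset.mem_range, show k < N + 1 by omega, if_true]
  have hsmall : ∀ᶠ N in atTop, ∀ k ∈ range K, ‖F N k‖ ≤ ‖f k‖ + 1 := by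
    rw [Filter.eventually_all_finset]
    intro k _
    have := (hlim k).norm.eventually (gt_mem_nhds (show ‖f k‖ < ‖f k‖ + 1 by linarith))
    exact this.mono fun N hN => hN.le
  have hbig : ∀ᶠ N : ℕ in atTop, 2 * B ≤ N := by
    obtain ⟨M, hM⟩ := exists_nat_ge (2 * B)
    filter_upwards [eventually_ge_atTop M] with N hN
    exact hM.trans (by exact_mod_cast hN)
  have := tendsto_tsum_of_dominated_convergence (𝓕 := atTop) (f := F) (g := f) sb hlim (by
    filter_upwards [hsmall, hbig] with N hN1 hN2 k
    by_cases hk : k < K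
    · have := hN1 k (by simpa using hk)
      rw [hb]; simp only [hk, if_true]; linarith [hgn k]
    · rw [hb]; simp only [hk, if_false, add_zero]
      by_cases hkN : k ∈ range (N + 1)
      · rw [hF]; simp only [hkN, if_true]
        have hkN' : k ≤ N := by simp at hkN; omega
        have r1 := rho1_bound N k hkN' (y k) (hδ0.le.trans (hK k (by omega)))
        have r2 := rho2_bound N k hkN' (y k) B (hB k) hN2
        have hn : ‖f k * (rho1 N k (y k) * rho2 N k (y k))‖
            = ‖f k‖ * (‖rho1 N k (y k)‖ * ‖rho2 N k (y k)‖) := by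
          rw [norm_mul (f k), norm_mul (rho1 N k (y k))]
        rw [hn]
        calc ‖f k‖ * (‖rho1 N k (y k)‖ * ‖rho2 N k (y k)‖) ≤ (C * ((k : ℝ) + 1) ^ (-(1 + 2 * δ))) * (1 * Real.exp (2 * B)) :=
              mul_le_mul (fb k (by omega)) (mul_le_mul r1 r2 (norm_nonneg _) zero_le_one)
                (by positivity) (by positivity)
          _ = g k := by rw [hg]; ring
      · rw [hF]; simp only [hkN, if_false, norm_zero]; exact hgn k)
  exact this.congr hFs

lemma w_bound (x : ℂ) : ∃ W : ℝ, ∀ k : ℕ, ‖1 / (x + k)‖ ≤ W / ((k : ℝ) + 1) := by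
  have h1 : Tendsto (fun N : ℕ => (N : ℂ) / ((N : ℂ) + x)) atTop (𝓝 1) :=
    tendsto_natCast_div_add_atTop x
  obtain ⟨W, hW⟩ := (h1.add (inv_limit x)).norm.bddAbove_range
  refine ⟨W, fun k => ?_⟩
  have := hW ⟨k, rfl⟩
  rw [le_div_iff₀ (by positivity)]
  have e : (k : ℂ) / (k + x) + (k + x)⁻¹ = (1 / (x + k)) * ((k + 1 : ℕ) : ℂ) := by
    rw [add_comm x]; push_cast; ring
  simp only [] at this
  rw [e, norm_mul, Complex.norm_natCast] at this
  push_cast at this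
  exact this

lemma poch_neg (k : ℕ) (d : ℂ) :
    poch ((1 - (k : ℂ)) / 2 - d) k ^ 2 = poch ((1 - (k : ℂ)) / 2 + d) k ^ 2 := by
  have : poch ((1 - (k : ℂ)) / 2 - d) k = (-1) ^ k * poch ((1 - (k : ℂ)) / 2 + d) k := by
    rw [poch, ← Finset.prod_range_reflect, poch]
    have : ∀ j ∈ range k, ((1 - (k : ℂ)) / 2 - d + ((k - 1 - j : ℕ) : ℂ))
        = (-1) * ((1 - (k : ℂ)) / 2 + d + j) := by
      intro j hj
      have hj := Finset.mem_range.mp hj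
      rw [show k - 1 - j = k - (j + 1) by omega, Nat.cast_sub (by omega)]
      push_cast; ring
    rw [Finset.prod_congr rfl this, Finset.prod_mul_distrib, Finset.prod_const]; simp
  rw [this, mul_pow, ← pow_mul, mul_comm k 2, pow_mul]; simp

lemma z_limit (p lam x₃ : ℂ) (z : ℕ → ℂ)
    (hz : ∀ k : ℕ, z k * (1 + k - z k) = p + lam * (x₃ + k))
    (hzre : ∀ k : ℕ, (z k).re ≤ (1 + (k : ℝ)) / 2) : Tendsto z atTop (𝓝 lam) := by
  set C := ‖p + lam * x₃‖ + ‖lam‖ with hC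
  have hC0 : 0 ≤ C := by positivity
  have zb : ∀ k, ‖z k‖ ≤ 2 * C := by
    intro k
    have hk : (0 : ℝ) ≤ k := Nat.cast_nonneg k
    have h1 : ‖z k‖ * ‖1 + k - z k‖ ≤ C * (1 + k) := by
      rw [← norm_mul, hz]
      calc ‖p + lam * (x₃ + k)‖ = ‖(p + lam * x₃) + lam * k‖ := by congr 1; ring
        _ ≤ ‖p + lam * x₃‖ + ‖lam‖ * k := by
          refine (norm_add_le _ _).trans ?_
          rw [norm_mul, Complex.norm_natCast]
        _ ≤ _ := by rw [hC]; nlinarith [norm_nonneg lam, norm_nonneg (p + lam * x₃)]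
    have h2 : (1 + (k : ℝ)) / 2 ≤ ‖1 + k - z k‖ := by
      have := Complex.re_le_norm (1 + k - z k)
      simp at this
      linarith [hzre k]
    have h3 := mul_le_mul_of_nonneg_left h2 (norm_nonneg (z k))
    by_contra hcon
    push Not at hcon
    nlinarith
  rw [tendsto_iff_norm_sub_tendsto_zero]
  have lim : Tendsto (fun k : ℕ => (‖p + lam * x₃ - lam‖ + (2 * C) ^ 2) * ‖((k : ℂ) + 1)⁻¹‖) atTop
      (𝓝 0) := by
    have := ((inv_limit 1).norm).const_mul (‖p + lam * x₃ - lam‖ + (2 * C) ^ 2)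
    simpa using this
  refine squeeze_zero (fun _ => norm_nonneg _) (fun k => ?_) lim
  have n8 : (k : ℂ) + 1 ≠ 0 := by exact_mod_cast k.succ_ne_zero
  have e : z k - lam = ((p + lam * x₃ - lam) + z k ^ 2) * ((k : ℂ) + 1)⁻¹ := by
    field_simp
    linear_combination hz k
  rw [e, norm_mul]
  refine mul_le_mul_of_nonneg_right ?_ (norm_nonneg _)
  refine (norm_add_le _ _).trans ?_
  rw [norm_pow]
  have := pow_le_pow_left₀ (norm_nonneg _) (zb k) 2
  linarith

/-- The asymmetric expansion of the Virasoro–Shapiro amplitude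
(end of Section 4). -/
theorem virasoro_shapiro_asymmetric (x₁ x₂ x₃ lam : ℂ)
    (hx3 : x₃ = 1 - x₁ - x₂) (hre : 0 < lam.re)
    (d : ℕ → ℂ)
    (hd : ∀ k : ℕ, d k ^ 2 = (1 + (k : ℂ)) ^ 2 / 4 - lam * (x₃ + k) - x₁ * x₂)
    (hx₁ : ∀ m : ℕ, x₁ ≠ -(m : ℂ))
    (hx₂ : ∀ m : ℕ, x₂ ≠ -(m : ℂ))
    (hx₃ : ∀ m : ℕ, x₃ ≠ -(m : ℂ))
    (hlam : ∀ m : ℕ, lam ≠ -(m : ℂ))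
    (heps : ∀ k : ℕ, ∀ m : ℕ,
      lam - (lam - x₁) * (lam - x₂) / (lam + k) ≠ -(m : ℂ))
    (hdp : ∀ k : ℕ, ∀ m : ℕ, (1 - (k : ℂ)) / 2 + d k ≠ -(m : ℂ))
    (hdm : ∀ k : ℕ, ∀ m : ℕ, (1 - (k : ℂ)) / 2 - d k ≠ -(m : ℂ)) :
    ∃ S₁ S₂ : ℂ,
      Tendsto (fun N : ℕ => ∑ k ∈ Finset.range N,
          (poch (1 - lam + (lam - x₁) * (lam - x₂) / (lam + k)) k ^ 2
            / ((k.factorial : ℂ)) ^ 2)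
          * (1 / (x₁ + k) + 1 / (x₂ + k) - 1 / (lam + k)))
        atTop (𝓝 S₁)
      ∧ Tendsto (fun N : ℕ => ∑ k ∈ Finset.range N,
          (poch ((1 - (k : ℂ)) / 2 + d k) k ^ 2 / ((k.factorial : ℂ)) ^ 2)
          * (1 / (x₃ + k)))
        atTop (𝓝 S₂)
      ∧ Complex.Gamma x₁ * Complex.Gamma x₂ * Complex.Gamma x₃
          / (Complex.Gamma (1 - x₁) * Complex.Gamma (1 - x₂)
            * Complex.Gamma (1 - x₃))
        = S₁ + S₂ := by
  have add0 : ∀ x : ℂ, (∀ m : ℕ, x ≠ -(m : ℂ)) → ∀ m : ℕ, (m : ℂ) + x ≠ 0 := by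
    intro x h m hm
    exact h m (by linear_combination hm)
  have hlam0 := add0 lam hlam
  have hlam' : ∀ m : ℕ, lam + (m : ℂ) ≠ 0 := fun m => by rw [add_comm]; exact hlam0 m
  -- choice of sign
  have hex : ∀ k : ℕ, ∃ e : ℂ, (e = d k ∨ e = -d k) ∧ 0 ≤ e.re := by
    intro k
    rcases le_total 0 (d k).re with h | h
    · exact ⟨d k, Or.inl rfl, h⟩
    · exact ⟨-d k, Or.inr rfl, by simpa using h⟩
  choose e he here using hex
  have he2 : ∀ k, e k ^ 2 = d k ^ 2 := by
    intro k
    rcases he k with h | h <;> rw [h]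
    ring
  set y : ℕ → ℂ := fun k => lam - (lam - x₁) * (lam - x₂) / (lam + k) with hydef
  set z : ℕ → ℂ := fun k => (1 + (k : ℂ)) / 2 - e k with hzdef
  have hy : ∀ k : ℕ, y k * (lam + k) = lam * (lam + k) - (lam - x₁) * (lam - x₂) := by
    intro k
    have := hlam' k
    simp only [hydef]
    field_simp
  have hz : ∀ k : ℕ, z k * (1 + k - z k) = x₁ * x₂ + lam * (x₃ + k) := by
    intro k
    simp only [hzdef]
    linear_combination -(he2 k) - hd k
  have hdp' : ∀ k m : ℕ, (m : ℂ) + (1 + (k : ℂ)) / 2 + d k ≠ 0 := by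
    intro k m h
    refine hdp k (m + k) ?_
    push_cast
    linear_combination h
  have hdm' : ∀ k m : ℕ, (m : ℂ) + (1 + (k : ℂ)) / 2 - d k ≠ 0 := by
    intro k m h
    refine hdm k (m + k) ?_
    push_cast
    linear_combination h
  have hz1 : ∀ k n : ℕ, (n : ℂ) + z k ≠ 0 := by
    intro k n h
    simp only [hzdef] at h
    rcases he k with h' | h' <;> rw [h'] at h
    · exact hdm' k n (by linear_combination h)
    · exact hdp' k n (by linear_combination h)
  have hz2 : ∀ k n : ℕ, (n : ℂ) + 1 + k - z k ≠ 0 := by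
    intro k n h
    simp only [hzdef] at h
    rcases he k with h' | h' <;> rw [h'] at h
    · exact hdp' k n (by linear_combination h)
    · exact hdm' k n (by linear_combination h)
  have hy1 : ∀ k n : ℕ, (n : ℂ) + y k ≠ 0 := fun k n => add0 _ (heps k) n
  have hy2 : ∀ k n : ℕ, (n : ℂ) + 1 + k - y k ≠ 0 := by
    intro k n h
    have h0 : ((k : ℂ) + (1 + (n : ℂ)) / 2 + d n) * ((k : ℂ) + (1 + (n : ℂ)) / 2 - d n) = 0 := by
      have hyk : y k = n + 1 + k := by linear_combination -h
      have h1 := hy k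
      rw [hyk] at h1
      have h2 := hd n
      rw [hx3] at h2
      linear_combination h1 - h2
    rcases mul_eq_zero.mp h0 with h1 | h1
    · exact hdp' n k h1
    · exact hdm' n k h1
  have hylim : Tendsto y atTop (𝓝 lam) := by
    have := ((inv_limit lam).const_mul ((lam - x₁) * (lam - x₂))).const_sub lam
    rw [mul_zero, sub_zero] at this
    refine this.congr fun k => ?_
    simp only [hydef]
    rw [add_comm lam, div_eq_mul_inv]
  have hzlim : Tendsto z atTop (𝓝 lam) := by
    refine z_limit (x₁ * x₂) lam x₃ z hz fun k => ?_
    have := here k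
    simp [hzdef]
    linarith
  obtain ⟨W1, hW1⟩ := w_bound x₁
  obtain ⟨W2, hW2⟩ := w_bound x₂
  obtain ⟨W3, hW3⟩ := w_bound x₃
  obtain ⟨W4, hW4⟩ := w_bound lam
  have hw : ∀ k : ℕ, ‖1 / (x₁ + k) + 1 / (x₂ + k) - 1 / (lam + k)‖
      ≤ (W1 + W2 + W4) / ((k : ℝ) + 1) := by
    intro k
    refine (norm_sub_le _ _).trans ?_
    have := norm_add_le (1 / (x₁ + (k : ℂ))) (1 / (x₂ + k))
    rw [add_div, add_div]
    linarith [hW1 k, hW2 k, hW4 k]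
  obtain ⟨s1, t1⟩ := tannery lam hre y (fun k => 1 / (x₁ + k) + 1 / (x₂ + k) - 1 / (lam + k))
    hylim _ hw hy1 hy2
  obtain ⟨s2, t2⟩ := tannery lam hre z (fun k => 1 / (x₃ + k)) hzlim _ hW3 hz1 hz2
  have L := gamma_limit x₁ x₂ x₃ hx3
  have R := ((const_limit lam hre).add t1).add t2
  have L' := L.congr (fun N => finite_id x₁ x₂ x₃ lam hx3 (add0 _ hx₁) (add0 _ hx₂) (add0 _ hx₃)
    hlam0 y z hy hz hy1 hy2 N)
  have E := tendsto_nhds_unique L' R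
  rw [zero_add] at E
  refine ⟨_, _, ?_, ?_, E⟩
  · refine s1.hasSum.tendsto_sum_nat.congr fun N => ?_
    refine Finset.sum_congr rfl fun k _ => ?_
    simp only [hydef]
    rw [show 1 - (lam - (lam - x₁) * (lam - x₂) / (lam + k))
      = 1 - lam + (lam - x₁) * (lam - x₂) / (lam + (k : ℂ)) by ring]
  · refine s2.hasSum.tendsto_sum_nat.congr fun N => ?_
    refine Finset.sum_congr rfl fun k _ => ?_
    have : poch (1 - z k) k ^ 2 = poch ((1 - (k : ℂ)) / 2 + d k) k ^ 2 := by
      simp only [hzdef]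
      rcases he k with h | h <;> rw [h]
      · congr 2; ring
      · rw [← poch_neg]; congr 2; ring
    rw [this]
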